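/- Suppose the sensor graph 𝒢 on {1,…,n} contains a rooted out-branching (equivalently, rank L(𝒢) = n−1) and the pairwise associations are noiseless, i.e. Π̃_{ij} = Π_{i0} Π_{j0}ᵀ for permutation matrices Π_{10},…,Π_{n0}. If m×m matrices Π_1(∞),…,Π_n(∞) form a fixed point of the consensus protocol, i.e. Π_i(∞) = (1/(|N_i|+1)) (Π_i(∞) + Σ_{j∈N_i} Π̃_{ij} Π_j(∞)) for all i, then there exists a single m×m matrix Q such that Π_i(∞) = Π_{i0} Q for every i. -/

import Mathlib

open Matrix

/-- An `m × m` real matrix is a permutation matrix if it is the matrix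
representation of some permutation `σ` of `{1,…,m}`. -/
def IsPermMatrix {m : ℕ} (M : Matrix (Fin m) (Fin m) ℝ) : Prop :=
  ∃ σ : Equiv.Perm (Fin m), M = fun i j => if σ j = i then 1 else 0

/-- If a square matrix of corank one annihilates the constant vectors, then every vector
in its kernel is constant. -/
theorem Matrix.apply_eq_apply_of_mulVec_eq_zero {ι K : Type*} [Fintype ι] [Field K]
    {L : Matrix ι ι K} (hrank : L.rank = Fintype.card ι - 1) (hone : L *ᵥ 1 = 0)
    {v : ι → K} (hv : L *ᵥ v = 0) (i j : ι) : v i = v j := by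
  have : Nonempty ι := ⟨i⟩
  have hker : Module.finrank K (LinearMap.ker L.mulVecLin) = 1 := by
    have h := L.mulVecLin.finrank_range_add_finrank_ker
    rw [Module.finrank_fintype_fun_eq_card] at h
    have hr : Module.finrank K (LinearMap.range L.mulVecLin) = Fintype.card ι - 1 := hrank
    have := Fintype.card_pos (α := ι)
    omega
  obtain ⟨c, hc⟩ := exists_smul_eq_of_finrank_eq_one hker
    (x := ⟨(1 : ι → K), hone⟩) (fun h => one_ne_zero (congrArg Subtype.val h)) ⟨v, hv⟩
  have hcv : c • (1 : ι → K) = v := congrArg Subtype.val hc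
  simp [← hcv]

theorem IsPermMatrix.transpose_mul_self {m : ℕ} {M : Matrix (Fin m) (Fin m) ℝ}
    (hM : IsPermMatrix M) : Mᵀ * M = 1 := by
  obtain ⟨σ, hσ⟩ := hM
  have hM (i j) : M i j = if σ j = i then 1 else 0 := by rw [hσ]
  ext i j
  simp [Matrix.mul_apply, Matrix.one_apply, hM, eq_comm]

/-- If the sensor graph contains a rooted out-branching
(equivalently `rank L(𝒢) = n - 1`) and the pairwise associations are noiseless
(`Π̃ᵢⱼ = Πᵢ₀ Πⱼ₀ᵀ` for permutation matrices `Πᵢ₀`), then any fixed point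
`Πᵢ(∞)` of the consensus protocol satisfies `Πᵢ(∞) = Πᵢ₀ Q` for a single
matrix `Q`. -/
theorem consensus_fixed_point_eq_labels_mul_common_matrix
    (n m : ℕ)
    (N : Fin n → Finset (Fin n))                      -- in-neighborhoods: j ∈ N i ↔ edge (j,i)
    (A Δ L : Matrix (Fin n) (Fin n) ℝ)
    (hA : A = fun i j => if j ∈ N i then 1 else 0)    -- adjacency matrix of the sensor graph
    (hΔ : Δ = Matrix.diagonal fun i => ((N i).card : ℝ))
    (hL : L = Δ - A)
    -- the sensor graph contains a rooted out-branching, equivalently: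
    (hrank : L.rank = n - 1)
    (Pt : Fin n → Fin n → Matrix (Fin m) (Fin m) ℝ)   -- pairwise associations Π̃ᵢⱼ
    (P0 : Fin n → Matrix (Fin m) (Fin m) ℝ)           -- ground-truth labels Πᵢ₀
    (hperm : ∀ i, IsPermMatrix (P0 i))
    (hnoiseless : ∀ i, ∀ j ∈ N i, Pt i j = P0 i * (P0 j)ᵀ)
    (X : Fin n → Matrix (Fin m) (Fin m) ℝ)            -- a fixed point Πᵢ(∞)
    (hfix : ∀ i, X i =
      (((N i).card : ℝ) + 1)⁻¹ • (X i + ∑ j ∈ N i, Pt i j * X j)) :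
    ∃ Q : Matrix (Fin m) (Fin m) ℝ, ∀ i, X i = P0 i * Q := by
  have hPtP (i) : (P0 i)ᵀ * P0 i = 1 := (hperm i).transpose_mul_self
  have hPPt (i) : P0 i * (P0 i)ᵀ = 1 := mul_eq_one_comm.mp (hPtP i)
  rcases Nat.eq_zero_or_pos n with rfl | hn
  · exact ⟨0, fun i => i.elim0⟩
  have hmulVec (v : Fin n → ℝ) (i : Fin n) :
      (L *ᵥ v) i = (N i).card * v i - ∑ j ∈ N i, v j := by
    have hA' (j) : A i j = if j ∈ N i then 1 else 0 := by rw [hA]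
    rw [hL, hΔ, Matrix.sub_mulVec, Pi.sub_apply, Matrix.mulVec_diagonal]
    simp [Matrix.mulVec, dotProduct, hA']
  have hone : L *ᵥ 1 = 0 := by
    ext i
    simp [hmulVec]
  have havg (i) : ((N i).card : ℝ) • ((P0 i)ᵀ * X i) = ∑ j ∈ N i, (P0 j)ᵀ * X j := by
    have hne : ((N i).card : ℝ) + 1 ≠ 0 := by positivity
    have h := (eq_inv_smul_iff₀ hne).mp (hfix i)
    rw [add_smul, one_smul, add_comm, add_right_inj] at h
    rw [← Matrix.mul_smul, h, Matrix.mul_sum]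
    refine Finset.sum_congr rfl fun j hj => ?_
    rw [hnoiseless i j hj, ← Matrix.mul_assoc, ← Matrix.mul_assoc, hPtP, Matrix.one_mul]
  refine ⟨(P0 ⟨0, hn⟩)ᵀ * X ⟨0, hn⟩, fun i => ?_⟩
  have hconst : (P0 i)ᵀ * X i = (P0 ⟨0, hn⟩)ᵀ * X ⟨0, hn⟩ := by
    ext a b
    refine Matrix.apply_eq_apply_of_mulVec_eq_zero (v := fun k => ((P0 k)ᵀ * X k) a b)
      (by simpa using hrank) hone ?_ i ⟨0, hn⟩
    ext k
    have h := congrFun (congrFun (havg k) a) b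
    rw [Matrix.smul_apply, Matrix.sum_apply, smul_eq_mul] at h
    rw [hmulVec, h, sub_self, Pi.zero_apply]
  rw [← hconst, ← Matrix.mul_assoc, hPPt, Matrix.one_mul]
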